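/- Let Z be a random d-vector with E Z = 0, E ZZ' = I_d, possessing a Lebesgue density f, let B be a d×p matrix with B'B = I_p (p ≤ d), let V ∼ N(0, I_d) with density φ, and for x ∈ ℝ^p set W^{x|B} = Bx + (I_d − BB')V. Then the function h(x|B) = E[ f(W^{x|B}) / φ(W^{x|B}) ] is a density of B'Z with respect to the p-variate standard Gaussian measure; that is, x ↦ h(x|B)·φ_p(x) is a Lebesgue density of B'Z, where φ_p is the N(0, I_p) density. -/

import Mathlib

open MeasureTheory ProbabilityTheory Matrix
open scoped ENNReal

/-- The standard Gaussian density on `ℝ^n`. -/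
noncomputable def stdGaussianPdf (n : ℕ) (v : Fin n → ℝ) : ℝ :=
  (2 * Real.pi) ^ (-(n : ℝ) / 2) * Real.exp (-(∑ i, v i ^ 2) / 2)

/-- `h(x|B) = E[f(W^{x|B})/φ(W^{x|B})]`, with `W^{x|B} = Bx + (I − BB')V`,
`V ∼ N(0,I_d)`. -/
noncomputable def hDensity {d p : ℕ} (f : (Fin d → ℝ) → ℝ)
    (B : Matrix (Fin d) (Fin p) ℝ) (x : Fin p → ℝ) : ℝ≥0∞ :=
  ∫⁻ v, ENNReal.ofReal
      (f (B.mulVec x + (1 - B * Bᵀ).mulVec v) /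
        stdGaussianPdf d (B.mulVec x + (1 - B * Bᵀ).mulVec v))
    ∂(Measure.pi fun _ : Fin d => gaussianReal 0 1)

lemma stdGaussianPdf_pos (n : ℕ) (v : Fin n → ℝ) : 0 < stdGaussianPdf n v := by
  unfold stdGaussianPdf
  positivity

@[fun_prop]
lemma measurable_stdGaussianPdf (n : ℕ) : Measurable (stdGaussianPdf n) := by
  unfold stdGaussianPdf
  fun_prop

lemma stdGaussianPdf_eq_prod (n : ℕ) (v : Fin n → ℝ) :
    stdGaussianPdf n v = ∏ i, gaussianPDFReal 0 1 (v i) := by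
  have hpi : (0 : ℝ) ≤ 2 * Real.pi := by positivity
  simp only [stdGaussianPdf, gaussianPDFReal, NNReal.coe_one, mul_one, sub_zero,
    Finset.prod_mul_distrib, Finset.prod_const, Finset.card_univ, Fintype.card_fin,
    ← Real.exp_sum]
  congr 1
  · rw [Real.sqrt_eq_rpow, ← Real.rpow_neg hpi, ← Real.rpow_mul_natCast hpi]
    ring_nf
  · rw [← Finset.sum_div, Finset.sum_neg_distrib]

/-- A standard Gaussian vector on `ℝ^n` has density `stdGaussianPdf n`. -/
lemma withDensity_stdGaussianPdf (n : ℕ) :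
    (volume : Measure (Fin n → ℝ)).withDensity (fun v => ENNReal.ofReal (stdGaussianPdf n v)) =
      Measure.pi fun _ : Fin n => gaussianReal 0 1 := by
  refine (Measure.pi_eq fun s hs => ?_).symm
  have hint (i : Fin n) : Integrable (gaussianPDFReal 0 1) (volume.restrict (s i)) :=
    (integrable_gaussianPDFReal 0 1).restrict
  simp_rw [withDensity_apply _ (MeasurableSet.univ_pi hs), volume_pi,
    Measure.restrict_pi_pi, stdGaussianPdf_eq_prod]
  rw [← ofReal_integral_eq_lintegral_ofReal (Integrable.fintype_prod hint)
    (ae_of_all _ fun v => Finset.prod_nonneg fun i _ => gaussianPDFReal_nonneg _ _ _),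
    integral_fintype_prod_eq_prod, ENNReal.ofReal_prod_of_nonneg
      fun i _ => integral_nonneg fun x => gaussianPDFReal_nonneg _ _ _]
  simp_rw [gaussianReal_apply_eq_integral 0 one_ne_zero]

lemma charFunDual_pi_gaussianReal {n : ℕ} (L : StrongDual ℝ (Fin n → ℝ)) :
    charFunDual (Measure.pi fun _ : Fin n => gaussianReal 0 1) L =
      Complex.exp (-((∑ i, L (Pi.single i 1) ^ 2 : ℝ) : ℂ) / 2) := by
  rw [charFunDual_pi]
  have h (i : Fin n) : charFunDual (gaussianReal 0 1) (L.comp (.single ℝ (fun _ => ℝ) i)) =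
      Complex.exp (-((L (Pi.single i 1) ^ 2 : ℝ) : ℂ) / 2) := by
    have hL (x : ℝ) : L.comp (.single ℝ (fun _ => ℝ) i) x = L (Pi.single i 1) * x := by
      rw [ContinuousLinearMap.comp_apply, ContinuousLinearMap.single_apply, mul_comm, ← smul_eq_mul, ← map_smul, ← Pi.single_smul, smul_eq_mul, mul_one]
    have hg := charFun_gaussianReal (μ := 0) (v := 1) (L (Pi.single i 1))
    rw [charFun_apply_real] at hg
    simp only [charFunDual_apply, hL]
    push_cast
    rw [hg]
    congr 1
    push_cast
    ring
  simp_rw [h, ← Complex.exp_sum]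
  congr 1
  push_cast
  rw [← Finset.sum_div, Finset.sum_neg_distrib]

/-- If `A` and `C` are matrices with `AA' + CC' = I`, then `AX + CY` is standard Gaussian for
independent standard Gaussian vectors `X` and `Y`. -/
lemma map_mulVec_add_mulVec_pi_gaussianReal {d p q : ℕ} (A : Matrix (Fin d) (Fin p) ℝ)
    (C : Matrix (Fin d) (Fin q) ℝ) (h : A * Aᵀ + C * Cᵀ = 1) :
    Measure.map (fun w : (Fin p → ℝ) × (Fin q → ℝ) => A.mulVec w.1 + C.mulVec w.2)
      ((Measure.pi fun _ : Fin p => gaussianReal 0 1).prod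
        (Measure.pi fun _ : Fin q => gaussianReal 0 1)) =
      Measure.pi fun _ : Fin d => gaussianReal 0 1 := by
  let T : (Fin p → ℝ) × (Fin q → ℝ) →L[ℝ] (Fin d → ℝ) :=
    A.mulVecLin.toContinuousLinearMap.coprod C.mulVecLin.toContinuousLinearMap
  change Measure.map T _ = _
  have : IsProbabilityMeasure (Measure.map T
      ((Measure.pi fun _ : Fin p => gaussianReal 0 1).prod
        (Measure.pi fun _ : Fin q => gaussianReal 0 1))) :=
    Measure.isProbabilityMeasure_map T.continuous.aemeasurable
  refine Measure.ext_of_charFunDual (funext fun L => ?_)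
  rw [charFunDual_map, charFunDual_prod]
  simp only [charFunDual_pi_gaussianReal, ← Complex.exp_add]
  set a : Fin d → ℝ := fun k => L (Pi.single k 1)
  have hL (y : Fin d → ℝ) : L y = a ⬝ᵥ y := by
    conv_lhs => rw [pi_eq_sum_univ' y]
    simp [a, dotProduct, map_sum, mul_comm]
  have hsq {r : ℕ} (D : Matrix (Fin d) (Fin r) ℝ) :
      ∑ i, L (D.mulVec (Pi.single i 1)) ^ 2 = a ⬝ᵥ (D * Dᵀ).mulVec a := by
    have h1 (i : Fin r) : L (D.mulVec (Pi.single i 1)) = (Dᵀ.mulVec a) i := by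
      rw [hL, dotProduct_mulVec, dotProduct_single_one, mulVec_transpose]
    rw [← mulVec_mulVec, dotProduct_mulVec, ← mulVec_transpose]
    simp only [h1, dotProduct, sq]
  have hsum : ∑ i, L (A.mulVec (Pi.single i 1)) ^ 2 + ∑ i, L (C.mulVec (Pi.single i 1)) ^ 2 =
      ∑ i, L (Pi.single i 1) ^ 2 := by
    rw [hsq, hsq, ← dotProduct_add, ← add_mulVec, h, one_mulVec]
    simp [a, dotProduct, sq]
  rw [← hsum]
  congr 1
  simp [T]
  ring

/-- If `Z` has Lebesgue density `f`, mean `0` and identity covariance, and `B'B = I_p`,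
then `x ↦ h(x|B)·φ_p(x)` is a Lebesgue density of `B'Z`; i.e. `h(·|B)` is a density of
`B'Z` with respect to the `p`-variate standard Gaussian measure. -/
theorem hDensity_is_density_of_projection {d p : ℕ} (hpd : p ≤ d)
    (f : (Fin d → ℝ) → ℝ) (hfm : Measurable f) (hf : ∀ z, 0 ≤ f z)
    (hprob : IsProbabilityMeasure (volume.withDensity fun z => ENNReal.ofReal (f z)))
    (hmean : ∀ i, ∫ z : Fin d → ℝ, z i
        ∂(volume.withDensity fun z => ENNReal.ofReal (f z)) = 0)
    (hcov : ∀ i j, ∫ z : Fin d → ℝ, z i * z j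
        ∂(volume.withDensity fun z => ENNReal.ofReal (f z)) = if i = j then 1 else 0)
    (B : Matrix (Fin d) (Fin p) ℝ) (hB : Bᵀ * B = 1) :
    Measure.map (fun z => Bᵀ.mulVec z) (volume.withDensity fun z => ENNReal.ofReal (f z)) =
      volume.withDensity fun x : Fin p → ℝ =>
        hDensity f B x * ENNReal.ofReal (stdGaussianPdf p x) := by
  set γd := Measure.pi fun _ : Fin d => gaussianReal 0 1 with hγd
  set γp := Measure.pi fun _ : Fin p => gaussianReal 0 1 with hγp
  set P : Matrix (Fin d) (Fin d) ℝ := 1 - B * Bᵀ with hP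
  have hBP : Bᵀ * P = 0 := by
    rw [hP, Matrix.mul_sub, ← Matrix.mul_assoc, hB, Matrix.mul_one, Matrix.one_mul, sub_self]
  have hPP : B * Bᵀ + P * Pᵀ = 1 := by
    have hPt : Pᵀ = P := by simp [hP]
    rw [hPt]
    nth_rw 2 [hP]
    rw [Matrix.sub_mul, Matrix.mul_assoc B, hBP]
    simp
  set g : (Fin d → ℝ) → ℝ≥0∞ := fun w => ENNReal.ofReal (f w / stdGaussianPdf d w) with hg
  have hgm : Measurable g := by fun_prop
  set S : (Fin p → ℝ) × (Fin d → ℝ) → (Fin d → ℝ) :=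
    fun w => B.mulVec w.1 + P.mulVec w.2 with hS
  have hSm : Measurable S := by
    have hc : Continuous S := by fun_prop
    exact hc.measurable
  have hTm : Measurable fun z : Fin d → ℝ => Bᵀ.mulVec z := by
    have hc : Continuous fun z : Fin d → ℝ => Bᵀ.mulVec z := by fun_prop
    exact hc.measurable
  have hh : hDensity f B = fun x => ∫⁻ v, g (S (x, v)) ∂γd := rfl
  have hhm : Measurable (hDensity f B) := by
    rw [hh]
    exact (hgm.comp hSm).lintegral_prod_right'
  have hR : (volume.withDensity fun x : Fin p → ℝ =>
      hDensity f B x * ENNReal.ofReal (stdGaussianPdf p x)) = γp.withDensity (hDensity f B) := by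
    rw [hγp, ← withDensity_stdGaussianPdf, ← withDensity_mul _ (by fun_prop) hhm]
    simp_rw [mul_comm (hDensity f B _)]
    rfl
  have hL : (volume.withDensity fun z => ENNReal.ofReal (f z)) = γd.withDensity g := by
    rw [hγd, ← withDensity_stdGaussianPdf, ← withDensity_mul _ (by fun_prop) hgm]
    congr 1
    ext z
    rw [Pi.mul_apply, hg, ← ENNReal.ofReal_mul (stdGaussianPdf_pos d z).le,
      mul_div_cancel₀ _ (stdGaussianPdf_pos d z).ne']
  rw [hR, hL]
  have hTS (x : Fin p → ℝ) (v : Fin d → ℝ) : Bᵀ.mulVec (S (x, v)) = x := by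
    simp [hS, mulVec_add, mulVec_mulVec, hB, hBP]
  ext A hA
  have hind : Measurable (((fun z => Bᵀ.mulVec z) ⁻¹' A).indicator g) :=
    hgm.indicator (hTm hA)
  rw [Measure.map_apply hTm hA, withDensity_apply _ (hTm hA), withDensity_apply _ hA,
    ← lintegral_indicator (hTm hA), ← lintegral_indicator hA, hγd,
    ← map_mulVec_add_mulVec_pi_gaussianReal B P hPP, lintegral_map hind hSm]
  refine (lintegral_prod _ (hind.comp hSm).aemeasurable).trans (lintegral_congr fun x => ?_)
  by_cases hx : x ∈ A
  · rw [Set.indicator_of_mem hx, hh]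
    exact lintegral_congr fun v => Set.indicator_of_mem (by simpa [hTS] using hx) _
  · rw [Set.indicator_of_notMem hx]
    refine (lintegral_congr fun v => Set.indicator_of_notMem ?_ _).trans lintegral_zero
    simpa [hTS] using hx
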